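/- Let f(x,y,z) = (x, y, Q₁(x,y,z), Q₂(x,y,z), Q₃(x,y,z)) where Q₁, Q₂, Q₃ are homogeneous quadratic polynomials, and let α be the 3×3 real matrix whose i-th row consists of the coefficients of z², xz and yz in Qᵢ. Then f is A²-equivalent to g₄(x,y,z) = (x,y,z²,0,0) if and only if the rank of α equals 1 and the column of z²-coefficients of α (its first column) is nonzero. -/

import Mathlib

noncomputable section

/-- Two smooth map germs `(ℝ³,0) → (ℝ⁵,0)` are `𝒜²`-equivalent: there are smooth
changes of coordinates in source and target, fixing the origin and with invertible
differential at the origin, such that the composites have the same 2-jet at `0`. -/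
def A2Equiv (f g : (Fin 3 → ℝ) → (Fin 5 → ℝ)) : Prop :=
  ∃ (ψ : (Fin 3 → ℝ) → (Fin 3 → ℝ)) (φ : (Fin 5 → ℝ) → (Fin 5 → ℝ))
    (ψ' : (Fin 3 → ℝ) ≃L[ℝ] (Fin 3 → ℝ)) (φ' : (Fin 5 → ℝ) ≃L[ℝ] (Fin 5 → ℝ)),
    ContDiff ℝ (⊤ : ℕ∞) ψ ∧ ContDiff ℝ (⊤ : ℕ∞) φ ∧ ψ 0 = 0 ∧ φ 0 = 0 ∧
    HasFDerivAt ψ (ψ' : (Fin 3 → ℝ) →L[ℝ] (Fin 3 → ℝ)) 0 ∧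
    HasFDerivAt φ (φ' : (Fin 5 → ℝ) →L[ℝ] (Fin 5 → ℝ)) 0 ∧
    ∀ k : ℕ, k ≤ 2 → iteratedFDeriv ℝ k (φ ∘ f ∘ ψ) 0 = iteratedFDeriv ℝ k g 0

def g1 : (Fin 3 → ℝ) → (Fin 5 → ℝ) := fun p => ![p 0, p 1, p 0 * p 2, p 1 * p 2, p 2 ^ 2]
def g2 : (Fin 3 → ℝ) → (Fin 5 → ℝ) := fun p => ![p 0, p 1, p 2 ^ 2, p 0 * p 2, 0]
def g3 : (Fin 3 → ℝ) → (Fin 5 → ℝ) := fun p => ![p 0, p 1, p 0 * p 2, p 1 * p 2, 0]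
def g4 : (Fin 3 → ℝ) → (Fin 5 → ℝ) := fun p => ![p 0, p 1, p 2 ^ 2, 0, 0]
def g5 : (Fin 3 → ℝ) → (Fin 5 → ℝ) := fun p => ![p 0, p 1, p 0 * p 2, 0, 0]
def g6 : (Fin 3 → ℝ) → (Fin 5 → ℝ) := fun p => ![p 0, p 1, 0, 0, 0]

/-- The second derivative of a composition of two `C²` maps. -/
theorem fderiv_fderiv_comp {E F G : Type*} [NormedAddCommGroup E] [NormedSpace ℝ E]
    [NormedAddCommGroup F] [NormedSpace ℝ F] [NormedAddCommGroup G] [NormedSpace ℝ G]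
    {φ : F → G} {h : E → F} (hφ : ContDiff ℝ 2 φ) (hh : ContDiff ℝ 2 h) (x u v : E) :
    fderiv ℝ (fderiv ℝ (φ ∘ h)) x u v =
      fderiv ℝ (fderiv ℝ φ) (h x) (fderiv ℝ h x u) (fderiv ℝ h x v) +
        fderiv ℝ φ (h x) (fderiv ℝ (fderiv ℝ h) x u v) := by
  have hφ1 : Differentiable ℝ φ := hφ.differentiable (by norm_num)
  have hh1 : Differentiable ℝ h := hh.differentiable (by norm_num)
  have hφ2 : Differentiable ℝ (fderiv ℝ φ) :=
    (hφ.fderiv_right (m := 1) (by norm_num)).differentiable (by norm_num)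
  have hh2 : Differentiable ℝ (fderiv ℝ h) :=
    (hh.fderiv_right (m := 1) (by norm_num)).differentiable (by norm_num)
  have key : fderiv ℝ (φ ∘ h) = fun y => (fderiv ℝ φ (h y)).comp (fderiv ℝ h y) := by
    funext y
    exact fderiv_comp y (hφ1 _) (hh1 _)
  have hd : HasFDerivAt (fun y => fderiv ℝ φ (h y))
      ((fderiv ℝ (fderiv ℝ φ) (h x)).comp (fderiv ℝ h x)) x :=
    (hφ2 (h x)).hasFDerivAt.comp x (hh1 x).hasFDerivAt
  rw [key, (hd.clm_comp (hh2 x).hasFDerivAt).fderiv]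
  simp [add_comm]

/-- A matrix with a vector `v` outside its kernel has rank one iff its range is the line
through the image of `v`. -/
theorem Matrix.rank_eq_one_iff_of_mulVec_ne_zero {m n K : Type*} [Fintype n] [Field K]
    (A : Matrix m n K) {v : n → K} (hv : A.mulVec v ≠ 0) :
    A.rank = 1 ↔ ∀ u, ∃ r : K, r • A.mulVec v = A.mulVec u := by
  have hv' : (⟨A.mulVecLin v, v, rfl⟩ : LinearMap.range A.mulVecLin) ≠ 0 :=
    fun h => hv (congrArg Subtype.val h)
  rw [Matrix.rank, finrank_eq_one_iff_of_nonzero' _ hv']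
  constructor
  · intro h u
    obtain ⟨r, hr⟩ := h ⟨A.mulVecLin u, u, rfl⟩
    exact ⟨r, congrArg Subtype.val hr⟩
  · rintro h ⟨_, u, rfl⟩
    obtain ⟨r, hr⟩ := h u
    exact ⟨r, Subtype.ext hr⟩

/-- The map `(x, y, Q₀, Q₁, Q₂)` whose quadratic forms have coefficients `c` on
`x², xy, y²` and `α` on `z², xz, yz`. -/
def mongeMap (c : Fin 3 → Fin 3 → ℝ) (α : Matrix (Fin 3) (Fin 3) ℝ) : (Fin 3 → ℝ) → (Fin 5 → ℝ) :=
  let Q : Fin 3 → (Fin 3 → ℝ) → ℝ := fun i p =>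
    c i 0 * p 0 ^ 2 + c i 1 * p 0 * p 1 + c i 2 * p 1 ^ 2
      + α i 0 * p 2 ^ 2 + α i 1 * p 0 * p 2 + α i 2 * p 1 * p 2
  fun p => ![p 0, p 1, Q 0 p, Q 1 p, Q 2 p]

theorem g4_eq_mongeMap : g4 = mongeMap 0 !![1, 0, 0; 0, 0, 0; 0, 0, 0] := by
  funext p
  simp [g4, mongeMap]

theorem contDiff_mongeMap (c : Fin 3 → Fin 3 → ℝ) (α : Matrix (Fin 3) (Fin 3) ℝ) {n : WithTop ℕ∞} :
    ContDiff ℝ n (mongeMap c α) := by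
  rw [contDiff_pi]
  intro i
  fin_cases i <;> simp [mongeMap] <;> fun_prop

/-- The derivative of `mongeMap`. -/
def mongeDeriv (c : Fin 3 → Fin 3 → ℝ) (α : Matrix (Fin 3) (Fin 3) ℝ) (p : Fin 3 → ℝ) :
    (Fin 3 → ℝ) →L[ℝ] (Fin 5 → ℝ) :=
  let x : (Fin 3 → ℝ) →L[ℝ] ℝ := ContinuousLinearMap.proj 0
  let y : (Fin 3 → ℝ) →L[ℝ] ℝ := ContinuousLinearMap.proj 1
  let z : (Fin 3 → ℝ) →L[ℝ] ℝ := ContinuousLinearMap.proj 2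
  let dQ : Fin 3 → ((Fin 3 → ℝ) →L[ℝ] ℝ) := fun i =>
    (2 * c i 0 * p 0 + c i 1 * p 1 + α i 1 * p 2) • x +
    (c i 1 * p 0 + 2 * c i 2 * p 1 + α i 2 * p 2) • y +
    (2 * α i 0 * p 2 + α i 1 * p 0 + α i 2 * p 1) • z
  ContinuousLinearMap.pi ![x, y, dQ 0, dQ 1, dQ 2]

theorem hasFDerivAt_mongeMap (c : Fin 3 → Fin 3 → ℝ) (α : Matrix (Fin 3) (Fin 3) ℝ) (p : Fin 3 → ℝ) :
    HasFDerivAt (mongeMap c α) (mongeDeriv c α p) p := by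
  have hp : ∀ i : Fin 3, HasFDerivAt (fun q : Fin 3 → ℝ => q i)
    (ContinuousLinearMap.proj i : (Fin 3 → ℝ) →L[ℝ] ℝ) p := fun i => hasFDerivAt_apply i p
  have hQ := fun i => ((((((hp 0).pow 2).const_mul (c i 0)).add
    (((hp 0).const_mul (c i 1)).mul (hp 1))).add (((hp 1).pow 2).const_mul (c i 2))).add
    (((hp 2).pow 2).const_mul (α i 0))).add (((hp 0).const_mul (α i 1)).mul (hp 2)) |>.add
    (((hp 1).const_mul (α i 2)).mul (hp 2))
  rw [hasFDerivAt_pi']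
  intro i
  fin_cases i
  · exact hp 0
  · exact hp 1
  all_goals
    first
    | refine (hQ 0).congr_fderiv ?_
    | refine (hQ 1).congr_fderiv ?_
    | refine (hQ 2).congr_fderiv ?_
    ext v
    simp [mongeDeriv]
    ring

theorem fderiv_mongeMap_zero (c : Fin 3 → Fin 3 → ℝ) (α : Matrix (Fin 3) (Fin 3) ℝ) (v : Fin 3 → ℝ) :
    fderiv ℝ (mongeMap c α) 0 v = ![v 0, v 1, 0, 0, 0] := by
  rw [(hasFDerivAt_mongeMap c α 0).fderiv]
  ext i
  fin_cases i <;> simp [mongeDeriv]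

theorem fderiv_fderiv_mongeMap (c : Fin 3 → Fin 3 → ℝ) (α : Matrix (Fin 3) (Fin 3) ℝ) (p v : Fin 3 → ℝ) :
    fderiv ℝ (fderiv ℝ (mongeMap c α)) p v (Pi.single 2 1) =
      ![0, 0, 2 * α 0 0 * v 2 + α 0 1 * v 0 + α 0 2 * v 1,
        2 * α 1 0 * v 2 + α 1 1 * v 0 + α 1 2 * v 1,
        2 * α 2 0 * v 2 + α 2 1 * v 0 + α 2 2 * v 1] := by
  have hd : Differentiable ℝ (fderiv ℝ (mongeMap c α)) :=
    ((contDiff_mongeMap c α (n := 2)).fderiv_right (m := 1) (by norm_num)).differentiable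
      (by norm_num)
  have h1 : HasFDerivAt (fun q => fderiv ℝ (mongeMap c α) q (Pi.single 2 1))
      ((fderiv ℝ (fderiv ℝ (mongeMap c α)) p).flip (Pi.single 2 1)) p := by
    simpa using (hd p).hasFDerivAt.clm_apply (hasFDerivAt_const (Pi.single 2 1) p)
  let z : Fin 3 → ((Fin 3 → ℝ) →L[ℝ] ℝ) := fun i =>
    (2 * α i 0) • ContinuousLinearMap.proj 2 + α i 1 • ContinuousLinearMap.proj 0 +
      α i 2 • ContinuousLinearMap.proj 1
  let L : (Fin 3 → ℝ) →L[ℝ] (Fin 5 → ℝ) := ContinuousLinearMap.pi ![0, 0, z 0, z 1, z 2]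
  have h2 : (fun q => fderiv ℝ (mongeMap c α) q (Pi.single 2 1)) = L := by
    funext q
    rw [(hasFDerivAt_mongeMap c α q).fderiv]
    ext i
    fin_cases i <;> simp [mongeDeriv, L, z]
  rw [h2] at h1
  have h3 := congrArg (fun T => T v) (h1.unique L.hasFDerivAt)
  simp only [ContinuousLinearMap.flip_apply] at h3
  rw [h3]
  ext i
  fin_cases i <;> simp [L, z]

theorem rank_eq_one_of_a2Equiv_mongeMap_g4 (c : Fin 3 → Fin 3 → ℝ)
    (α : Matrix (Fin 3) (Fin 3) ℝ) (h : A2Equiv (mongeMap c α) g4) :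
    α.rank = 1 ∧ ∃ i, α i 0 ≠ 0 := by
  obtain ⟨ψ, φ, P, R, hψ, hφ, hψ0, -, hP, hR, hjet⟩ := h
  set f := mongeMap c α with hf
  have hψ2 : ContDiff ℝ 2 ψ := by exact_mod_cast contDiff_infty.1 hψ 2
  have hφ2 : ContDiff ℝ 2 φ := by exact_mod_cast contDiff_infty.1 hφ 2
  have hf2 : ContDiff ℝ 2 f := contDiff_mongeMap c α
  have hf0 : f 0 = 0 := by
    ext i
    fin_cases i <;> simp [hf, mongeMap]
  have hfψ : HasFDerivAt (f ∘ ψ) ((fderiv ℝ f 0).comp (P : (Fin 3 → ℝ) →L[ℝ] (Fin 3 → ℝ))) 0 :=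
    HasFDerivAt.comp (0 : Fin 3 → ℝ)
      (by rw [hψ0]; exact (hf2.differentiable (by norm_num) 0).hasFDerivAt) hP
  have hF : HasFDerivAt (φ ∘ f ∘ ψ) ((R : (Fin 5 → ℝ) →L[ℝ] (Fin 5 → ℝ)).comp
      ((fderiv ℝ f 0).comp (P : (Fin 3 → ℝ) →L[ℝ] (Fin 3 → ℝ)))) 0 :=
    HasFDerivAt.comp (0 : Fin 3 → ℝ) (by simpa [hψ0, hf0] using hR) hfψ
  have first : ∀ v, R ![P v 0, P v 1, 0, 0, 0] = ![v 0, v 1, 0, 0, 0] := by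
    intro v
    have := congrArg (fun T => T ![v]) (hjet 1 (by norm_num))
    simp only [iteratedFDeriv_one_apply, hF.fderiv, g4_eq_mongeMap] at this
    simpa only [hf, ContinuousLinearMap.comp_apply, ContinuousLinearEquiv.coe_coe,
      fderiv_mongeMap_zero, Matrix.cons_val_zero] using this
  set e : Fin 3 → ℝ := Pi.single 2 1 with he
  have hPe : P e 0 = 0 ∧ P e 1 = 0 := by
    have h0 := first e
    have : ![P e 0, P e 1, 0, 0, 0] = (0 : Fin 5 → ℝ) := by
      apply R.injective
      rw [h0, map_zero]
      ext i
      fin_cases i <;> simp [he]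
    exact ⟨congrFun this 0, congrFun this 1⟩
  set l := P e 2 with hl
  have hPe' : P e = l • e := by
    ext i
    fin_cases i
    · simpa [he] using hPe.1
    · simpa [he] using hPe.2
    · simp [hl, he]
  have hl0 : l ≠ 0 := by
    intro h0
    rw [h0, zero_smul] at hPe'
    have := congrFun ((map_eq_zero_iff P P.injective).1 hPe') 2
    simp [he] at this
  have second : ∀ v, ∃ a b, R ![a, b, l * α.mulVec ![2 * P v 2, P v 0, P v 1] 0,
      l * α.mulVec ![2 * P v 2, P v 0, P v 1] 1,
      l * α.mulVec ![2 * P v 2, P v 0, P v 1] 2] = ![0, 0, 2 * v 2, 0, 0] := by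
    intro v
    have := congrArg (fun T => T ![v, e]) (hjet 2 le_rfl)
    simp only [iteratedFDeriv_two_apply, g4_eq_mongeMap, Matrix.cons_val_zero,
      Matrix.cons_val_one] at this
    rw [fderiv_fderiv_comp hφ2 (hf2.comp hψ2), fderiv_fderiv_comp hf2 hψ2, he,
      fderiv_fderiv_mongeMap, ← he, hfψ.fderiv, hP.fderiv, Function.comp_apply, hψ0, hf0,
      hR.fderiv] at this
    simp only [ContinuousLinearMap.comp_apply, ContinuousLinearEquiv.coe_coe, hPe', map_smul] at this
    rw [hf, fderiv_mongeMap_zero c α e, he, fderiv_fderiv_mongeMap, ← he,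
      fderiv_mongeMap_zero] at this
    have hz : ![e 0, e 1, 0, 0, 0] = (0 : Fin 5 → ℝ) := by
      ext i
      fin_cases i <;> simp [he]
    rw [hz, map_zero, smul_zero, zero_add, fderiv_mongeMap_zero] at this
    refine ⟨fderiv ℝ (fderiv ℝ ψ) 0 v e 0, fderiv ℝ (fderiv ℝ ψ) 0 v e 1, ?_⟩
    convert this using 2
    · ext i
      fin_cases i <;> simp [Matrix.mulVec, dotProduct, Fin.sum_univ_three, -mul_eq_mul_left_iff] <;> ring
    · simp
  set w : Fin 5 → ℝ := R.symm ![0, 0, 1, 0, 0] with hw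
  set m : Fin 3 → ℝ := ![w 2, w 3, w 4] with hm
  have hαm : ∀ v, l • α.mulVec ![2 * P v 2, P v 0, P v 1] = (2 * v 2) • m := by
    intro v
    obtain ⟨a, b, hab⟩ := second v
    have h1 : (![0, 0, 2 * v 2, 0, 0] : Fin 5 → ℝ) = (2 * v 2) • ![0, 0, 1, 0, 0] := by simp
    rw [h1, ← R.eq_symm_apply, map_smul, ← hw] at hab
    ext i
    fin_cases i
    · exact congrFun hab 2
    · exact congrFun hab 3
    · exact congrFun hab 4
  have hm0 : m ≠ 0 := by
    intro h0
    have hv := first (P.symm ![w 0, w 1, 0])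
    have h1 : ![w 0, w 1, 0, 0, 0] = w := by
      ext i
      fin_cases i
      · rfl
      · rfl
      · exact (congrFun h0 0).symm
      · exact (congrFun h0 1).symm
      · exact (congrFun h0 2).symm
    simp only [P.apply_symm_apply, Matrix.cons_val_zero, Matrix.cons_val_one] at hv
    rw [h1, hw, R.apply_symm_apply] at hv
    simpa using congrFun hv 2
  have hcol : (l * l) • α.mulVec ![1, 0, 0] = m := by
    have h2 := hαm ((2⁻¹ : ℝ) • e)
    have h3 : (![2 * P ((2⁻¹ : ℝ) • e) 2, P ((2⁻¹ : ℝ) • e) 0, P ((2⁻¹ : ℝ) • e) 1] :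
        Fin 3 → ℝ) = l • ![1, 0, 0] := by
      simp [hPe, ← hl]
    rw [h3, Matrix.mulVec_smul, smul_smul] at h2
    rw [h2]
    simp [he]
  have hne : α.mulVec ![1, 0, 0] ≠ 0 := by
    intro h0
    rw [h0, smul_zero] at hcol
    exact hm0 hcol.symm
  refine ⟨(α.rank_eq_one_iff_of_mulVec_ne_zero hne).2 fun u => ?_, ?_⟩
  · have h2 := hαm (P.symm ![u 1, u 2, u 0 / 2])
    have h3 : ![2 * (u 0 / 2), u 1, u 2] = u := by
      ext i
      fin_cases i <;> simp
      ring
    simp only [P.apply_symm_apply, Matrix.cons_val] at h2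
    rw [h3, ← hcol, smul_smul] at h2
    exact ⟨_, by rw [← inv_smul_smul₀ hl0 (α.mulVec u), h2, smul_smul]⟩
  · by_contra! h0
    apply hne
    ext i
    simp [Matrix.mulVec, dotProduct, Fin.sum_univ_three, h0]

/-- Extension of an automorphism of `ℝⁿ` to `ℝⁿ⁺¹` by the identity on the new first coordinate. -/
def consExtend {n : ℕ} (M : (Fin n → ℝ) ≃L[ℝ] (Fin n → ℝ)) :
    (Fin (n + 1) → ℝ) ≃L[ℝ] (Fin (n + 1) → ℝ) :=
  ((Fin.consEquivL ℝ (fun _ : Fin (n + 1) => ℝ)).symm.trans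
    ((ContinuousLinearEquiv.refl ℝ ℝ).prodCongr M)).trans
      (Fin.consEquivL ℝ (fun _ : Fin (n + 1) => ℝ))

theorem consExtend_vecCons {n : ℕ} (M : (Fin n → ℝ) ≃L[ℝ] (Fin n → ℝ)) (a : ℝ) (v : Fin n → ℝ) :
    consExtend M (Matrix.vecCons a v) = Matrix.vecCons a (M v) :=
  rfl

/-- The shear `(x, y, z) ↦ (x, y, z - s x - t y)`. -/
def shear (s t : ℝ) : (Fin 3 → ℝ) ≃L[ℝ] (Fin 3 → ℝ) :=
  LinearEquiv.toContinuousLinearEquiv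
    { toFun := fun p => ![p 0, p 1, p 2 - s * p 0 - t * p 1]
      invFun := fun p => ![p 0, p 1, p 2 + s * p 0 + t * p 1]
      map_add' := fun p q => by
        ext i
        fin_cases i <;> simp
        ring
      map_smul' := fun r p => by
        ext i
        fin_cases i <;> simp
        ring
      left_inv := fun p => by
        ext i
        fin_cases i <;> simp
        ring
      right_inv := fun p => by
        ext i
        fin_cases i <;> simp
        ring }

theorem shear_apply (s t : ℝ) (p : Fin 3 → ℝ) :
    shear s t p = ![p 0, p 1, p 2 - s * p 0 - t * p 1] :=
  rfl

/-- The change of coordinates subtracting the quadratic forms in `x, y` with coefficients `d`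
from the last three coordinates of `ℝ⁵`. -/
def subQuadratic (d : Fin 3 → Fin 3 → ℝ) (p : Fin 5 → ℝ) : Fin 5 → ℝ :=
  let k : Fin 3 → ℝ := fun i => d i 0 * p 0 ^ 2 + d i 1 * p 0 * p 1 + d i 2 * p 1 ^ 2
  ![p 0, p 1, p 2 - k 0, p 3 - k 1, p 4 - k 2]

theorem contDiff_subQuadratic (d : Fin 3 → Fin 3 → ℝ) {n : WithTop ℕ∞} :
    ContDiff ℝ n (subQuadratic d) := by
  rw [contDiff_pi]
  intro i
  fin_cases i <;> simp [subQuadratic] <;> fun_prop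

theorem hasFDerivAt_subQuadratic_zero (d : Fin 3 → Fin 3 → ℝ) :
    HasFDerivAt (subQuadratic d) (ContinuousLinearMap.id ℝ (Fin 5 → ℝ)) 0 := by
  have hp : ∀ i : Fin 5, HasFDerivAt (fun q : Fin 5 → ℝ => q i)
    (ContinuousLinearMap.proj i : (Fin 5 → ℝ) →L[ℝ] ℝ) 0 := fun i => hasFDerivAt_apply i 0
  have hk := fun i => ((((hp 0).pow 2).const_mul (d i 0)).add
    (((hp 0).const_mul (d i 1)).mul (hp 1))).add (((hp 1).pow 2).const_mul (d i 2))
  rw [hasFDerivAt_pi']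
  intro i
  fin_cases i
  · exact hp 0
  · exact hp 1
  · exact ((hp 2).sub (hk 0)).congr_fderiv (by ext; simp)
  · exact ((hp 3).sub (hk 1)).congr_fderiv (by ext; simp)
  · exact ((hp 4).sub (hk 2)).congr_fderiv (by ext; simp)

theorem a2Equiv_mongeMap_g4_of_rank_eq_one (c : Fin 3 → Fin 3 → ℝ)
    (α : Matrix (Fin 3) (Fin 3) ℝ) (hα : α.rank = 1) (h0 : ∃ i, α i 0 ≠ 0) :
    A2Equiv (mongeMap c α) g4 := by
  set a : Fin 3 → ℝ := fun i => α i 0 with ha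
  have ha0 : a ≠ 0 := fun h => h0.elim fun i hi => hi (congrFun h i)
  have hcol : ∀ j, α.mulVec (Pi.single j 1) = fun i => α i j := fun j => by
    ext i
    simp
  have hne : α.mulVec (Pi.single 0 1) ≠ 0 := by rwa [hcol]
  have hr := (α.rank_eq_one_iff_of_mulVec_ne_zero hne).1 hα
  obtain ⟨s, hs⟩ := hr (Pi.single 1 1)
  obtain ⟨t, ht⟩ := hr (Pi.single 2 1)
  rw [hcol, hcol] at hs ht
  have hs' : ∀ i, α i 1 = s * a i := fun i => (congrFun hs i).symm
  have ht' : ∀ i, α i 2 = t * a i := fun i => (congrFun ht i).symm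
  have hone : (![1, 0, 0] : Fin 3 → ℝ) ≠ 0 := fun h => by simpa using congrFun h 0
  obtain ⟨M, hM⟩ := SeparatingDual.exists_continuousLinearEquiv_apply_eq (R := ℝ) ha0 hone
  let d : Fin 3 → Fin 3 → ℝ := fun i =>
    ![c i 0 - a i * s ^ 2 / 4, c i 1 - a i * s * t / 2, c i 2 - a i * t ^ 2 / 4]
  let R := consExtend (consExtend M)
  have hcomp : (R ∘ subQuadratic d) ∘ mongeMap c α ∘ shear (s / 2) (t / 2) = g4 := by
    funext p
    have hsub : subQuadratic d (mongeMap c α (shear (s / 2) (t / 2) p)) =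
        Matrix.vecCons (p 0) (Matrix.vecCons (p 1) (p 2 ^ 2 • a)) := by
      ext i
      fin_cases i <;>
        simp [subQuadratic, mongeMap, shear_apply, d, hs', ht'] <;> simp only [ha] <;> ring
    simp only [Function.comp_apply, hsub, R, consExtend_vecCons, map_smul, hM]
    simp [g4]
  refine ⟨shear (s / 2) (t / 2), R ∘ subQuadratic d, shear (s / 2) (t / 2), R,
    (shear (s / 2) (t / 2)).contDiff, R.contDiff.comp (contDiff_subQuadratic d), map_zero _, ?_,
    (shear (s / 2) (t / 2)).hasFDerivAt, ?_, fun k _ => by rw [hcomp]⟩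
  · have : subQuadratic d 0 = 0 := by
      ext i
      fin_cases i <;> simp [subQuadratic]
    simp [this]
  · exact R.hasFDerivAt.comp 0 (hasFDerivAt_subQuadratic_zero d)

/-- A corank 1 map in Monge form is `𝒜²`-equivalent to `(x,y,z²,0,0)` iff the
coefficient matrix `α` of `z², xz, yz` has rank one and nonzero first column
(the `z²`-coefficients). -/
theorem A2_equiv_g4_iff
    (c : Fin 3 → Fin 3 → ℝ) (α : Matrix (Fin 3) (Fin 3) ℝ)
    (Q : Fin 3 → (Fin 3 → ℝ) → ℝ)
    (hQ : ∀ i p, Q i p = c i 0 * p 0 ^ 2 + c i 1 * p 0 * p 1 + c i 2 * p 1 ^ 2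
        + α i 0 * p 2 ^ 2 + α i 1 * p 0 * p 2 + α i 2 * p 1 * p 2)
    (f : (Fin 3 → ℝ) → (Fin 5 → ℝ))
    (hf : ∀ p, f p = ![p 0, p 1, Q 0 p, Q 1 p, Q 2 p]) :
    A2Equiv f g4 ↔ (α.rank = 1 ∧ ∃ i, α i 0 ≠ 0) := by
  have hfm : f = mongeMap c α := by
    funext p
    rw [hf]
    simp only [hQ, mongeMap]
  rw [hfm]
  exact ⟨rank_eq_one_of_a2Equiv_mongeMap_g4 c α,
    fun h => a2Equiv_mongeMap_g4_of_rank_eq_one c α h.1 h.2⟩
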